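/- arXiv:2105.02421 — 3 statements merged into one kernel-verified Lean document; each statement's English description precedes it below -/
import Mathlib

section
/- Let f : ℝ → ℝ be integrable with f(v) > 0 for all v, with v ↦ v f(v) and v ↦ v² f(v) integrable, and define ρ = ∫_ℝ f dv, u by ρu = ∫_ℝ v f dv, E = ∫_ℝ (1/2)v² f dv, and T by E = (1/2)ρu² + (1/2)ρT; assume ρ > 0, T > 0 and let M_U(v) = ρ/√(2πT) · exp(−(v−u)²/(2T)). Assume moreover that v ↦ (M_U(v) − f(v))·log f(v) and v ↦ (M_U(v) − f(v))·log M_U(v) are integrable. Then the BGK operator dissipates entropy: ∫_ℝ (M_U(v) − f(v))·log f(v) dv ≤ 0. -/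
open MeasureTheory Real

open ProbabilityTheory in
lemma integrable_sub_sq_mul_gaussianPDFReal (u : ℝ) {T : NNReal} (hT : T ≠ 0) :
    Integrable (fun v => (v - u) ^ 2 * gaussianPDFReal u T v) := by
  have h : Integrable (fun v => (v - u) ^ 2) (gaussianReal u T) :=
    ((memLp_id_gaussianReal 2).sub (memLp_const u)).integrable_sq
  rw [gaussianReal_of_var_ne_zero u hT, integrable_withDensity_iff (measurable_gaussianPDF u T)
    (ae_of_all _ fun _ => gaussianPDF_lt_top)] at h
  simpa only [toReal_gaussianPDF] using h

open ProbabilityTheory in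
lemma integral_sub_sq_mul_gaussianPDFReal (u : ℝ) {T : NNReal} (hT : T ≠ 0) :
    ∫ v, (v - u) ^ 2 * gaussianPDFReal u T v = T := by
  rw [← variance_fun_id_gaussianReal (μ := u) (v := T),
    variance_eq_integral measurable_id'.aemeasurable, integral_id_gaussianReal,
    integral_gaussianReal_eq_integral_smul hT]
  simp only [smul_eq_mul, mul_comm]

lemma sub_mul_log_sub_log_nonneg {x y : ℝ} (hx : 0 < x) (hy : 0 < y) :
    0 ≤ (x - y) * (Real.log x - Real.log y) := by
  rcases le_total x y with h | h
  · exact mul_nonneg_of_nonpos_of_nonpos (sub_nonpos.2 h) (sub_nonpos.2 (Real.log_le_log hx h))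
  · exact mul_nonneg (sub_nonneg.2 h) (sub_nonneg.2 (Real.log_le_log hy h))

/-- Entropy dissipation of the BGK operator: `∫ (M_U − f) log f ≤ 0`. -/
theorem bgk_entropy_dissipation (f : ℝ → ℝ)
    (hf : Integrable f)
    (hfpos : ∀ v, 0 < f v)
    (hvf : Integrable (fun v => v * f v))
    (hv2f : Integrable (fun v => v ^ 2 * f v))
    (ρ u E T : ℝ)
    (hρdef : ρ = ∫ v : ℝ, f v)
    (hudef : ρ * u = ∫ v : ℝ, v * f v)
    (hEdef : E = ∫ v : ℝ, (1 / 2) * v ^ 2 * f v)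
    (hTdef : E = (1 / 2) * ρ * u ^ 2 + (1 / 2) * ρ * T)
    (hρ : 0 < ρ) (hT : 0 < T)
    (M : ℝ → ℝ)
    (hM : ∀ v, M v = ρ / Real.sqrt (2 * Real.pi * T) * Real.exp (-(v - u) ^ 2 / (2 * T)))
    (hint1 : Integrable (fun v => (M v - f v) * Real.log (f v)))
    (hint2 : Integrable (fun v => (M v - f v) * Real.log (M v))) :
    (∫ v : ℝ, (M v - f v) * Real.log (f v)) ≤ 0 := by
  lift T to NNReal using hT.le
  have hT0 : T ≠ 0 := by rintro rfl; simp at hT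
  have hMpdf : M = fun v => ρ * ProbabilityTheory.gaussianPDFReal u T v := by
    funext v
    rw [hM, ProbabilityTheory.gaussianPDFReal, div_eq_mul_inv, mul_assoc]
  have hMpos : ∀ v, 0 < M v := fun v => by rw [hM]; positivity
  have hMint : Integrable M := by
    rw [hMpdf]; exact (ProbabilityTheory.integrable_gaussianPDFReal u T).const_mul ρ
  have hMmass : ∫ v, M v = ρ := by
    rw [hMpdf, integral_const_mul, ProbabilityTheory.integral_gaussianPDFReal_eq_one u hT0, mul_one]
  have hMsq_eq : (fun v => (v - u) ^ 2 * M v) =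
      fun v => ρ * ((v - u) ^ 2 * ProbabilityTheory.gaussianPDFReal u T v) := by
    funext v; rw [hMpdf]; ring
  have hMsq_int : Integrable (fun v => (v - u) ^ 2 * M v) := by
    rw [hMsq_eq]; exact (integrable_sub_sq_mul_gaussianPDFReal u hT0).const_mul ρ
  have hMsq : ∫ v, (v - u) ^ 2 * M v = ρ * T := by
    rw [hMsq_eq, integral_const_mul, integral_sub_sq_mul_gaussianPDFReal u hT0]
  have hfsq_eq : (fun v => (v - u) ^ 2 * f v) =
      fun v => v ^ 2 * f v - 2 * u * (v * f v) + u ^ 2 * f v := by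
    funext v; ring
  have hfsq_int : Integrable (fun v => (v - u) ^ 2 * f v) := by
    rw [hfsq_eq]; exact (hv2f.sub (hvf.const_mul _)).add (hf.const_mul _)
  have hfsq : ∫ v, (v - u) ^ 2 * f v = ρ * T := by
    simp only [mul_assoc (1 / 2 : ℝ), integral_const_mul] at hEdef
    rw [hfsq_eq, integral_add (by exact hv2f.sub (hvf.const_mul _)) (hf.const_mul _),
      integral_sub hv2f (hvf.const_mul _), integral_const_mul, integral_const_mul,
      ← hρdef, ← hudef]
    linear_combination 2 * hTdef - 2 * hEdef
  have hlogM : ∀ v, Real.log (M v) =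
      Real.log (ρ / Real.sqrt (2 * Real.pi * T)) - (2 * (T : ℝ))⁻¹ * (v - u) ^ 2 := fun v => by
    rw [hM, Real.log_mul (by positivity) (Real.exp_ne_zero _), Real.log_exp]
    ring
  have hzero : ∫ v, (M v - f v) * Real.log (M v) = 0 := by
    have heq : (fun v => (M v - f v) * Real.log (M v)) = fun v =>
        Real.log (ρ / Real.sqrt (2 * Real.pi * T)) * (M v - f v)
          - (2 * (T : ℝ))⁻¹ * ((v - u) ^ 2 * M v - (v - u) ^ 2 * f v) := by
      funext v; rw [hlogM]; ring
    rw [heq, integral_sub (by exact (hMint.sub hf).const_mul _)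
        (by exact (hMsq_int.sub hfsq_int).const_mul _),
      integral_const_mul, integral_const_mul, integral_sub hMint hf,
      integral_sub hMsq_int hfsq_int, hMmass, hMsq, hfsq, ← hρdef]
    ring
  rw [← hzero]
  refine integral_mono hint1 hint2 fun v => ?_
  have := sub_mul_log_sub_log_nonneg (hMpos v) (hfpos v)
  rw [mul_sub] at this
  exact sub_nonneg.1 this
end

section
/- Let I = [a, b] with a < b, let p : ℝ → ℝ be continuous on I, and set p̄ = (1/(b−a))∫_a^b p(x) dx, M' = max_{x∈I} p(x), m' = min_{x∈I} p(x). Let m, M be real numbers with m ≤ p̄ ≤ M, and assume m' < p̄ < M'. Define the limiter parameter θ = min{ |(M − p̄)/(M' − p̄)|, |(m − p̄)/(m' − p̄)|, 1 } and the limited function p̃(x) = θ·(p(x) − p̄) + p̄. Then the limiter is conservative, ∫_a^b p̃(x) dx = ∫_a^b p(x) dx, and locally maximum-principle preserving: m ≤ p̃(x) ≤ M for every x ∈ I. -/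
open MeasureTheory

/-- The LMPP limiter `p̃ = θ(p − p̄) + p̄` is conservative and locally
maximum-principle preserving. -/
theorem lmpp_limiter_conservative_and_bounds
    (a b : ℝ) (hab : a < b) (p : ℝ → ℝ) (hp : ContinuousOn p (Set.Icc a b))
    (pbar M' m' m M θ : ℝ) (ptilde : ℝ → ℝ)
    (hpbar : pbar = (b - a)⁻¹ * ∫ x in a..b, p x)
    (hM' : IsGreatest (p '' Set.Icc a b) M')
    (hm' : IsLeast (p '' Set.Icc a b) m')
    (hmpbar : m ≤ pbar) (hpbarM : pbar ≤ M)
    (hm'pbar : m' < pbar) (hpbarM' : pbar < M')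
    (hθ : θ = min (min (|(M - pbar) / (M' - pbar)|) (|(m - pbar) / (m' - pbar)|)) 1)
    (hptilde : ∀ x, ptilde x = θ * (p x - pbar) + pbar) :
    (∫ x in a..b, ptilde x) = (∫ x in a..b, p x) ∧
    ∀ x ∈ Set.Icc a b, m ≤ ptilde x ∧ ptilde x ≤ M := by
  have hba : 0 < b - a := sub_pos.2 hab
  have hint : IntervalIntegrable p volume a b :=
    ContinuousOn.intervalIntegrable (by rwa [Set.uIcc_of_le hab.le])
  have hmean : (b - a) * pbar = ∫ x in a..b, p x := by
    rw [hpbar, mul_inv_cancel_left₀ hba.ne']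
  have hM'pos : 0 < M' - pbar := sub_pos.2 hpbarM'
  have hm'pos : 0 < pbar - m' := sub_pos.2 hm'pbar
  have hθ0 : 0 ≤ θ := by rw [hθ]; positivity
  have hθM : θ * (M' - pbar) ≤ M - pbar := by
    rw [← le_div_iff₀ hM'pos, ← abs_of_nonneg (div_nonneg (sub_nonneg.2 hpbarM) hM'pos.le), hθ]
    exact (min_le_left _ _).trans (min_le_left _ _)
  have hθm : θ * (pbar - m') ≤ pbar - m := by
    rw [← le_div_iff₀ hm'pos, ← abs_of_nonneg (div_nonneg (sub_nonneg.2 hmpbar) hm'pos.le),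
      ← neg_sub m, ← neg_sub m', neg_div_neg_eq, hθ]
    exact (min_le_left _ _).trans (min_le_right _ _)
  refine ⟨?_, fun x hx => ?_⟩
  · simp only [hptilde]
    rw [intervalIntegral.integral_add ((hint.sub intervalIntegrable_const).const_mul θ)
        intervalIntegrable_const, intervalIntegral.integral_const_mul,
      intervalIntegral.integral_sub hint intervalIntegrable_const,
      intervalIntegral.integral_const, smul_eq_mul, hmean]
    ring
  · have hxM : p x ≤ M' := hM'.2 (Set.mem_image_of_mem p hx)
    have hxm : m' ≤ p x := hm'.2 (Set.mem_image_of_mem p hx)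
    have hupper := mul_le_mul_of_nonneg_left (sub_le_sub_right hxM pbar) hθ0
    have hlower := mul_le_mul_of_nonneg_left (sub_le_sub_left hxm pbar) hθ0
    rw [hptilde]
    constructor <;> linarith
end

section
/- (Explicit evaluation of the macroscopic fields in the implicit backward-Euler step.) Let ε > 0 and Δt > 0. Let f, f* : ℝ → ℝ be integrable with v ↦ v f(v), v ↦ v² f(v), v ↦ v f*(v), v ↦ v² f*(v) integrable. Define ρ = ∫_ℝ f dv, u by ρu = ∫_ℝ v f dv, E = ∫_ℝ (1/2)v² f dv, and T by E = (1/2)ρu² + (1/2)ρT; assume ρ > 0 and T > 0, and let M_U(v) = ρ/√(2πT) · exp(−(v−u)²/(2T)) be the Maxwellian built from the moments of f. Suppose f satisfies the implicit relation f(v) = f*(v) + (Δt/ε)·(M_U(v) − f(v)) for all v. Then the macroscopic moments of f coincide with those of f*: ∫_ℝ f dv = ∫_ℝ f* dv, ∫_ℝ v f dv = ∫_ℝ v f* dv, and ∫_ℝ (1/2)v² f dv = ∫_ℝ (1/2)v² f* dv; hence the implicit update's macroscopic fields can be computed explicitly from f*. -/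
open MeasureTheory Real

/-- Integrating a weight against the Maxwellian of density `ρ`, velocity `u` and temperature `T`
is `ρ` times its expectation under the Gaussian of mean `u` and variance `T`. -/
lemma integral_mul_maxwellian (w : ℝ → ℝ) (ρ u : ℝ) {T : ℝ} (hT : 0 < T) :
    ∫ v, w v * (ρ / √(2 * π * T) * exp (-(v - u) ^ 2 / (2 * T))) =
      ρ * ∫ v, w v ∂ProbabilityTheory.gaussianReal u T.toNNReal := by
  rw [ProbabilityTheory.integral_gaussianReal_eq_integral_smul (by simpa using hT),
    ← integral_const_mul]
  refine integral_congr_ae (.of_forall fun v ↦ ?_)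
  simp only [ProbabilityTheory.gaussianPDFReal, Real.coe_toNNReal T hT.le, smul_eq_mul]
  ring

/-- The second moment of a real Gaussian is the square of its mean plus its variance. -/
lemma integral_sq_gaussianReal (u : ℝ) (T : NNReal) :
    ∫ v, v ^ 2 ∂ProbabilityTheory.gaussianReal u T = u ^ 2 + T := by
  have h := ProbabilityTheory.variance_eq_sub
    (ProbabilityTheory.memLp_id_gaussianReal (μ := u) (v := T) 2)
  simp only [ProbabilityTheory.variance_id_gaussianReal, Pi.pow_apply, id_eq,
    ProbabilityTheory.integral_id_gaussianReal] at h
  linarith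

/-- A weighted moment shared by `f` and the relaxation target `M` is preserved by an implicit
relaxation step `f = g + c (M - f)`. -/
lemma integral_mul_eq_of_implicit_relaxation {α : Type*} [MeasurableSpace α] {μ : Measure α}
    {w f g M : α → ℝ} {c : ℝ} (hf : Integrable (fun x ↦ w x * f x) μ)
    (hg : Integrable (fun x ↦ w x * g x) μ) (himp : ∀ x, f x = g x + c * (M x - f x))
    (hM : ∫ x, w x * M x ∂μ = ∫ x, w x * f x ∂μ) :
    ∫ x, w x * f x ∂μ = ∫ x, w x * g x ∂μ := by
  rcases eq_or_ne c 0 with rfl | hc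
  · exact integral_congr_ae (.of_forall fun x ↦ by simpa using congrArg (w x * ·) (himp x))
  have hMi : Integrable (fun x ↦ w x * M x) μ := by
    refine (((hf.sub hg).const_mul c⁻¹).add hf).congr (.of_forall fun x ↦ ?_)
    have h : c⁻¹ * (f x - g x) = M x - f x := by
      rw [inv_mul_eq_iff_eq_mul₀ hc]
      linarith [himp x]
    simp only [Pi.add_apply, Pi.sub_apply]
    linear_combination w x * h
  calc ∫ x, w x * f x ∂μ = ∫ x, (w x * g x + c * (w x * M x - w x * f x)) ∂μ :=
        integral_congr_ae (.of_forall fun x ↦ by linear_combination w x * himp x)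
    _ = ∫ x, w x * g x ∂μ := by
        rw [integral_add hg (by exact (hMi.sub hf).const_mul c), integral_const_mul, integral_sub hMi hf,
          hM, sub_self, mul_zero, add_zero]

/-- Explicit evaluation of the macroscopic fields in the implicit backward-Euler
step: if `f = f* + (Δt/ε)(M_U − f)` with `M_U` the Maxwellian built from the
moments of `f`, then the macroscopic moments of `f` coincide with those of `f*`. -/
theorem backward_euler_macroscopic_fields
    (ε Δt : ℝ) (hε : 0 < ε) (hΔt : 0 < Δt)
    (f fstar : ℝ → ℝ)
    (hf : Integrable f)
    (hvf : Integrable (fun v => v * f v))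
    (hv2f : Integrable (fun v => v ^ 2 * f v))
    (hfstar : Integrable fstar)
    (hvfstar : Integrable (fun v => v * fstar v))
    (hv2fstar : Integrable (fun v => v ^ 2 * fstar v))
    (ρ u E T : ℝ)
    (hρdef : ρ = ∫ v : ℝ, f v)
    (hudef : ρ * u = ∫ v : ℝ, v * f v)
    (hEdef : E = ∫ v : ℝ, (1 / 2) * v ^ 2 * f v)
    (hTdef : E = (1 / 2) * ρ * u ^ 2 + (1 / 2) * ρ * T)
    (hρ : 0 < ρ) (hT : 0 < T)
    (M : ℝ → ℝ)
    (hM : ∀ v, M v = ρ / Real.sqrt (2 * Real.pi * T) * Real.exp (-(v - u) ^ 2 / (2 * T)))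
    (himplicit : ∀ v, f v = fstar v + (Δt / ε) * (M v - f v)) :
    (∫ v : ℝ, f v) = (∫ v : ℝ, fstar v) ∧
    (∫ v : ℝ, v * f v) = (∫ v : ℝ, v * fstar v) ∧
    (∫ v : ℝ, (1 / 2) * v ^ 2 * f v) = (∫ v : ℝ, (1 / 2) * v ^ 2 * fstar v) := by
  obtain rfl : M = fun v ↦ ρ / √(2 * π * T) * exp (-(v - u) ^ 2 / (2 * T)) := funext hM
  refine ⟨?_, ?_, ?_⟩
  · have h := integral_mul_eq_of_implicit_relaxation (w := fun _ ↦ 1) (by simpa using hf)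
      (by simpa using hfstar) himplicit
      (by rw [integral_mul_maxwellian _ _ _ hT]; simp [← hρdef])
    simpa only [one_mul] using h
  · refine integral_mul_eq_of_implicit_relaxation hvf hvfstar himplicit ?_
    rw [integral_mul_maxwellian _ _ _ hT, ProbabilityTheory.integral_id_gaussianReal, hudef]
  · refine integral_mul_eq_of_implicit_relaxation (w := fun v ↦ 1 / 2 * v ^ 2)
      (by simpa only [mul_assoc] using hv2f.const_mul (1 / 2))
      (by simpa only [mul_assoc] using hv2fstar.const_mul (1 / 2)) himplicit ?_
    rw [integral_mul_maxwellian _ _ _ hT, integral_const_mul, integral_sq_gaussianReal,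
      Real.coe_toNNReal T hT.le, ← hEdef, hTdef]
    ring
end
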